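/- For every n ≥ 0, the central part of row n+3 of the hyperbolic Pascal triangle {4,5} is a repetition of the whole row n: row n+3 has s_{n+3} vertices with s_{n+3} − s_n even, and the contiguous block of s_n vertices of row n+3 starting at position (s_{n+3} − s_n)/2 satisfies: the value of each vertex of the block is twice the value of the corresponding vertex of row n, and the type of each vertex of the block equals the type of the corresponding vertex of row n, with wingers of row n corresponding to type-B vertices of the block. -/

import Mathlib

/-- Type of a vertex in a hyperbolic Pascal triangle: winger, A, or B. -/
inductive HVType where
  | W : HVType
  | A : HVType
  | B : HVType
deriving DecidableEq, Repr

/-- Number of type-B children produced by a vertex of the given type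
in the hyperbolic Pascal triangle `{4,q}`. -/
def hBCount (q : ℕ) : HVType → ℕ
  | .A => q - 4
  | .B => q - 3
  | .W => 0

/-- The inner part of the next row: for each pair of consecutive vertices a shared
type-A child whose value is the sum of the parents' values, followed by the
type-B copies of the right parent. -/
def hMid (q : ℕ) : List (HVType × ℕ) → List (HVType × ℕ)
  | a :: b :: rest =>
      (HVType.A, a.2 + b.2) ::
        (List.replicate (hBCount q b.1) (HVType.B, b.2) ++ hMid q (b :: rest))
  | _ => []

/-- Row `n` of the hyperbolic Pascal triangle `{4,q}`, as a list of
(type, value) pairs read from left to right. -/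
def hRow (q : ℕ) : ℕ → List (HVType × ℕ)
  | 0 => [(HVType.W, 1)]
  | n + 1 => (HVType.W, 1) :: (hMid q (hRow q n) ++ [(HVType.W, 1)])

/-- Number of type-A vertices of row `n`. -/
def hCountA (q n : ℕ) : ℕ := ((hRow q n).filter (fun v => v.1 = HVType.A)).length

/-- Number of type-B vertices of row `n`. -/
def hCountB (q n : ℕ) : ℕ := ((hRow q n).filter (fun v => v.1 = HVType.B)).length

/-- Sum of the values of the type-A vertices of row `n`. -/
def hSumA (q n : ℕ) : ℕ :=
  (((hRow q n).filter (fun v => v.1 = HVType.A)).map Prod.snd).sum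

/-- Sum of the values of the type-B vertices of row `n`. -/
def hSumB (q n : ℕ) : ℕ :=
  (((hRow q n).filter (fun v => v.1 = HVType.B)).map Prod.snd).sum

/-- The number `s_n` of vertices of row `n`. -/
def hLen (q n : ℕ) : ℕ := (hRow q n).length

/-- The value of the `k`-th (0-indexed) vertex of row `n`. -/
def hVal (q n k : ℕ) : ℕ := ((hRow q n).getD k (HVType.W, 0)).2

/-- The type of the `k`-th (0-indexed) vertex of row `n`. -/
def hType (q n k : ℕ) : HVType := ((hRow q n).getD k (HVType.W, 0)).1

open HVType

/-- The vertex of the central block of row `n + 3` corresponding to a vertex of row `n`. -/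
def hDouble (v : HVType × ℕ) : HVType × ℕ := (if v.1 = W then B else v.1, 2 * v.2)

theorem hMid_append_cons (q : ℕ) (X : List (HVType × ℕ)) (b : HVType × ℕ)
    (Y : List (HVType × ℕ)) :
    hMid q (X ++ b :: Y) = hMid q (X ++ [b]) ++ hMid q (b :: Y) := by
  induction X with
  | nil => simp [hMid]
  | cons a X ih => cases X <;> simp_all [hMid]

theorem hMid_concat_B (a : HVType × ℕ) (X : List (HVType × ℕ)) (v : ℕ) :
    hMid 5 (a :: (X ++ [(B, v)])) = hMid 5 (a :: (X ++ [(W, v)])) ++ [(B, v), (B, v)] := by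
  induction X generalizing a with
  | nil => simp [hMid, hBCount, List.replicate]
  | cons b X ih => simp [hMid, ih]

theorem fst_ne_W_of_mem_hMid (q : ℕ) (l : List (HVType × ℕ)) :
    ∀ x ∈ hMid q l, x.1 ≠ W := by
  induction l with
  | nil => simp [hMid]
  | cons a l ih =>
    cases l with
    | nil => simp [hMid]
    | cons b l =>
      intro x hx
      simp only [hMid, List.mem_cons, List.mem_append, List.mem_replicate] at hx
      rcases hx with rfl | ⟨-, rfl⟩ | hx
      · simp
      · simp
      · exact ih x hx

theorem hMid_map_hDouble (t : HVType) (a : HVType × ℕ) (v : ℕ) (M : List (HVType × ℕ))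
    (hM : ∀ x ∈ M, x.1 ≠ W) :
    hMid 5 ((t, 2 * a.2) :: (M.map hDouble ++ [(W, 2 * v)])) =
      (hMid 5 (a :: (M ++ [(W, v)]))).map hDouble := by
  induction M generalizing t a with
  | nil => simp [hMid, hBCount, hDouble, mul_add]
  | cons b M ih =>
    have hb : b.1 ≠ W := hM b (by simp)
    have ih' := ih b.1 b fun x hx => hM x (by simp [hx])
    have hbd : hDouble b = (b.1, 2 * b.2) := by simp [hDouble, hb]
    simp only [List.map_cons, List.cons_append, hMid, hbd, ih', List.map_append,
      List.map_replicate]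
    simp [hDouble, mul_add]

theorem countP_A_hMid (a : HVType × ℕ) (l : List (HVType × ℕ)) :
    (hMid 5 (a :: l)).countP (·.1 = A) = l.length := by
  induction l generalizing a with
  | nil => simp [hMid]
  | cons b l ih => simp [hMid, ih, List.countP_replicate]

theorem countP_B_hMid (a : HVType × ℕ) (l : List (HVType × ℕ)) :
    (hMid 5 (a :: l)).countP (·.1 = B) =
      l.countP (·.1 = A) + 2 * l.countP (·.1 = B) := by
  induction l generalizing a with
  | nil => simp [hMid]
  | cons b l ih =>
    obtain ⟨t, v⟩ := b
    cases t <;> simp [hMid, ih, hBCount] <;> omega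

theorem length_hMid (a : HVType × ℕ) (l : List (HVType × ℕ)) :
    (hMid 5 (a :: l)).length =
      l.length + l.countP (·.1 = A) + 2 * l.countP (·.1 = B) := by
  induction l generalizing a with
  | nil => simp [hMid]
  | cons b l ih =>
    obtain ⟨t, v⟩ := b
    cases t <;> simp [hMid, ih, hBCount] <;> omega

/-- Row `n + 3` is the doubled row `n` flanked by two blocks with equal numbers of
vertices of each type. -/
theorem hRow_add_three (n : ℕ) : ∃ P Q : List (HVType × ℕ),
    hRow 5 (n + 3) = (W, 1) :: (P ++ ((hRow 5 n).map hDouble ++ (Q ++ [(W, 1)]))) ∧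
    P.length = Q.length ∧ P.countP (·.1 = A) = Q.countP (·.1 = A) ∧
    P.countP (·.1 = B) = Q.countP (·.1 = B) := by
  induction n with
  | zero => exact ⟨[(A, 3)], [(A, 3)], by decide, rfl, rfl, rfl⟩
  | succ n ih =>
    cases n with
    | zero =>
      exact ⟨[(A, 4), (B, 3), (A, 5)], [(A, 5), (B, 3), (A, 4)], by decide, rfl, rfl, rfl⟩
    | succ n =>
      obtain ⟨P, Q, h, hl, hA, hB⟩ := ih
      set M := hMid 5 (hRow 5 n)
      have hR : hRow 5 (n + 1) = (W, 1) :: (M ++ [(W, 1)]) := rfl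
      have hD : hDouble (W, 1) = (B, 2) := rfl
      refine ⟨hMid 5 ((W, 1) :: (P ++ [(W, 2)])) ++ [(B, 2)],
        (B, 2) :: hMid 5 ((B, 2) :: (Q ++ [(W, 1)])), ?_, ?_, ?_, ?_⟩
      · have hmid := hMid_map_hDouble B (W, 1) 1 M (fst_ne_W_of_mem_hMid 5 _)
        rw [mul_one] at hmid
        have e : hRow 5 (n + 1 + 3) = ((W, 1) :: P) ++ (B, 2) ::
            (M.map hDouble ++ (B, 2) :: (Q ++ [(W, 1)])) := by
          rw [h, hR]; simp [hD]
        have s : hRow 5 (n + 1 + 1 + 3) =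
            (W, 1) :: (hMid 5 (hRow 5 (n + 1 + 3)) ++ [(W, 1)]) := rfl
        have s' : hRow 5 (n + 1 + 1) = (W, 1) :: (hMid 5 (hRow 5 (n + 1)) ++ [(W, 1)]) := rfl
        rw [s, s', e, hMid_append_cons, List.cons_append, hMid_concat_B,
          ← List.cons_append (a := (B, 2)) (as := M.map hDouble), hMid_append_cons,
          List.cons_append, hMid_concat_B, hmid, hR]
        simp [hD]
      · simp [length_hMid, hl, hA, hB]
      · simp [countP_A_hMid, hl]
      · simp [countP_B_hMid, hA, hB]

/-- the central part of row `n+3` of the hyperbolic Pascal triangle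
`{4,5}` repeats the whole row `n`: `s_{n+3} - s_n` is even, and the central block of
`s_n` vertices of row `n+3` has twice the values of row `n` and the same types
(wingers of row `n` corresponding to type-B vertices of the block). -/
theorem stmt_13 (n : ℕ) :
    Even (hLen 5 (n + 3) - hLen 5 n) ∧
    ∀ k, k < hLen 5 n →
      hVal 5 (n + 3) ((hLen 5 (n + 3) - hLen 5 n) / 2 + k) = 2 * hVal 5 n k ∧
      hType 5 (n + 3) ((hLen 5 (n + 3) - hLen 5 n) / 2 + k)
        = (if hType 5 n k = HVType.W then HVType.B else hType 5 n k) := by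
  obtain ⟨P, Q, h, hl, -, -⟩ := hRow_add_three n
  have hd : hLen 5 (n + 3) - hLen 5 n = 2 * (P.length + 1) := by
    simp only [hLen, h, List.length_cons, List.length_append, List.length_map, List.length_nil]
    omega
  rw [hd]
  refine ⟨even_two_mul _, fun k hk => ?_⟩
  have key : (hRow 5 (n + 3)).getD (2 * (P.length + 1) / 2 + k) (W, 0) =
      hDouble ((hRow 5 n).getD k (W, 0)) := by
    have hk' : k < (hRow 5 n).length := hk
    rw [Nat.mul_div_cancel_left _ two_pos, h, ← List.cons_append,
      List.getD_append_right _ _ _ _ (by simp), List.getD_append _ _ _ _ (by simpa using hk')]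
    simp [hk']
  exact ⟨congrArg Prod.snd key, congrArg Prod.fst key⟩
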